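/- Compact embedding of X₀: let Ω ⊂ ℝ^N be a smooth bounded domain, s ∈ (0,1), p satisfying (P1)–(P2) with s·p⁺ < N, and let r ∈ C₊(Ω̄) with 1 < r(x) < p*_s(x) := N p̄(x)/(N − s p̄(x)) for all x ∈ Ω̄. Then there exists a constant C = C(N,s,p,r,Ω) > 0 such that ‖u‖_{L^{r(x)}(Ω)} ≤ C ‖u‖_{X₀} for every u ∈ X₀; moreover the embedding X₀ ↪ L^{r(x)}(Ω) is compact, i.e. every bounded sequence in X₀ has a subsequence converging strongly in L^{r(x)}(Ω). -/

import Mathlib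

open MeasureTheory Real Set Filter Topology

noncomputable section

abbrev Euc (N : ℕ) := EuclideanSpace ℝ (Fin N)

/-- `Φ⁻ := inf_D Φ`. -/
def infOn {X : Type*} (g : X → ℝ) (D : Set X) : ℝ := sInf (g '' D)

/-- `Φ⁺ := sup_D Φ`. -/
def supOn {X : Type*} (g : X → ℝ) (D : Set X) : ℝ := sSup (g '' D)

/-- `C₊(D)`: continuous on `D` with `1 < g⁻ ≤ g⁺ < ∞`. -/
def CPlus {X : Type*} [TopologicalSpace X] (D : Set X) (g : X → ℝ) : Prop :=
  ContinuousOn g D ∧ 1 < infOn g D ∧ BddAbove (g '' D)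

variable {N : ℕ}

/-- the modular `ρ_γ(u) = ∫_Ω |u|^{γ(x)} dx`. -/
def modular (Ω : Set (Euc N)) (γ u : Euc N → ℝ) : ℝ := ∫ x in Ω, |u x| ^ γ x

/-- membership in the variable exponent Lebesgue space `L^{γ(x)}(Ω)`. -/
def MemVarLp (Ω : Set (Euc N)) (γ u : Euc N → ℝ) : Prop :=
  AEMeasurable u (volume.restrict Ω) ∧ IntegrableOn (fun x => |u x| ^ γ x) Ω

/-- the Luxemburg norm on `L^{γ(x)}(Ω)`. -/
def luxNorm (Ω : Set (Euc N)) (γ u : Euc N → ℝ) : ℝ :=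
  sInf {η : ℝ | 0 < η ∧ (∫ x in Ω, (|u x| / η) ^ γ x) ≤ 1}

/-- the scaled Gagliardo modular over a set `D ⊆ ℝ^N × ℝ^N`. -/
def gagliardoOn (D : Set (Euc N × Euc N)) (s : ℝ) (p : Euc N × Euc N → ℝ)
    (u : Euc N → ℝ) (η : ℝ) : ℝ :=
  ∫ z in D, |u z.1 - u z.2| ^ p z / (η ^ p z * ‖z.1 - z.2‖ ^ ((N : ℝ) + s * p z))

/-- the seminorm `[u]_Ω^{s,p(x,y)}` of `W`. -/
def Wseminorm (Ω : Set (Euc N)) (s : ℝ) (p : Euc N × Euc N → ℝ) (u : Euc N → ℝ) : ℝ :=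
  sInf {η : ℝ | 0 < η ∧ gagliardoOn (Ω ×ˢ Ω) s p u η < 1}

/-- the norm of `W = W^{s,p̄(x),p(x,y)}(Ω)`. -/
def WNorm (Ω : Set (Euc N)) (s : ℝ) (p : Euc N × Euc N → ℝ) (u : Euc N → ℝ) : ℝ :=
  luxNorm Ω (fun x => p (x, x)) u + Wseminorm Ω s p u

/-- membership in `W = W^{s,p̄(x),p(x,y)}(Ω)`. -/
def MemW (Ω : Set (Euc N)) (s : ℝ) (p : Euc N × Euc N → ℝ) (u : Euc N → ℝ) : Prop :=
  Measurable u ∧ IntegrableOn (fun x => |u x| ^ p (x, x)) Ω ∧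
    ∃ η > (0 : ℝ), IntegrableOn
      (fun z : Euc N × Euc N =>
        |u z.1 - u z.2| ^ p z / (η ^ p z * ‖z.1 - z.2‖ ^ ((N : ℝ) + s * p z))) (Ω ×ˢ Ω)

/-- the modular `ρ_{X₀}`. -/
def rhoX0 (s : ℝ) (p : Euc N × Euc N → ℝ) (u : Euc N → ℝ) : ℝ :=
  ∫ z : Euc N × Euc N, |u z.1 - u z.2| ^ p z / ‖z.1 - z.2‖ ^ ((N : ℝ) + s * p z)

/-- the Luxemburg-type norm of `X₀`. -/
def X0Norm (s : ℝ) (p : Euc N × Euc N → ℝ) (u : Euc N → ℝ) : ℝ :=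
  sInf {η : ℝ | 0 < η ∧ gagliardoOn univ s p u η ≤ 1}

/-- membership in `X₀`: vanishing a.e. outside `Ω` and finite scaled Gagliardo modular. -/
def MemX0 (Ω : Set (Euc N)) (s : ℝ) (p : Euc N × Euc N → ℝ) (u : Euc N → ℝ) : Prop :=
  Measurable u ∧ (∀ᵐ x ∂(volume : Measure (Euc N)), x ∉ Ω → u x = 0) ∧
    ∃ η > (0 : ℝ), Integrable
      (fun z : Euc N × Euc N =>
        |u z.1 - u z.2| ^ p z / (η ^ p z * ‖z.1 - z.2‖ ^ ((N : ℝ) + s * p z)))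

/-- the norm `‖(u,v)‖ = max {‖u‖_{X₀}, ‖v‖_{X₀}}` on `E = X₀ × X₀`. -/
def pairNorm (s : ℝ) (p : Euc N × Euc N → ℝ) (u v : Euc N → ℝ) : ℝ :=
  max (X0Norm s p u) (X0Norm s p v)

/-- the critical exponent `p*_s(x) = N p̄(x)/(N − s p̄(x))`. -/
def pstar (N : ℕ) (s : ℝ) (p : Euc N × Euc N → ℝ) (x : Euc N) : ℝ :=
  (N : ℝ) * p (x, x) / ((N : ℝ) - s * p (x, x))

/-- `P(u,v)`. -/
def Pfun (s : ℝ) (p : Euc N × Euc N → ℝ) (u v : Euc N → ℝ) : ℝ :=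
  ∫ z : Euc N × Euc N,
    (|u z.1 - u z.2| ^ p z + |v z.1 - v z.2| ^ p z) / ‖z.1 - z.2‖ ^ ((N : ℝ) + s * p z)

/-- `Q(u,v)`. -/
def Qfun (Ω : Set (Euc N)) (q a b : Euc N → ℝ) (lam mu : ℝ) (u v : Euc N → ℝ) : ℝ :=
  ∫ x in Ω, (lam * a x * |u x| ^ q x + mu * b x * |v x| ^ q x)

/-- `R(u,v)`. -/
def Rfun (Ω : Set (Euc N)) (α β c : Euc N → ℝ) (u v : Euc N → ℝ) : ℝ :=
  ∫ x in Ω, c x * |u x| ^ α x * |v x| ^ β x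

/-- the energy functional `J_{λ,μ}`. -/
def Jfun (Ω : Set (Euc N)) (s : ℝ) (p : Euc N × Euc N → ℝ) (q α β a b c : Euc N → ℝ)
    (lam mu : ℝ) (u v : Euc N → ℝ) : ℝ :=
  (∫ z : Euc N × Euc N,
      (|u z.1 - u z.2| ^ p z + |v z.1 - v z.2| ^ p z) /
        (p z * ‖z.1 - z.2‖ ^ ((N : ℝ) + s * p z)))
  - (∫ x in Ω, (lam * a x * |u x| ^ q x + mu * b x * |v x| ^ q x) / q x)
  - ∫ x in Ω, c x * |u x| ^ α x * |v x| ^ β x / (α x + β x)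

/-- `φ''_{u,v}(1)`, the second derivative at `t = 1` of the fibering map. -/
def phiSecond (Ω : Set (Euc N)) (s : ℝ) (p : Euc N × Euc N → ℝ) (q α β a b c : Euc N → ℝ)
    (lam mu : ℝ) (u v : Euc N → ℝ) : ℝ :=
  (∫ z : Euc N × Euc N,
      (p z - 1) * (|u z.1 - u z.2| ^ p z + |v z.1 - v z.2| ^ p z) /
        ‖z.1 - z.2‖ ^ ((N : ℝ) + s * p z))
  - (∫ x in Ω, (q x - 1) * (lam * a x * |u x| ^ q x + mu * b x * |v x| ^ q x))
  - ∫ x in Ω, (α x + β x - 1) * (c x * |u x| ^ α x * |v x| ^ β x)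

/-- `(u,v) ≠ (0,0)` in `E`. -/
def Nontriv (u v : Euc N → ℝ) : Prop :=
  ¬ (u =ᵐ[(volume : Measure (Euc N))] 0 ∧ v =ᵐ[(volume : Measure (Euc N))] 0)

/-- membership in the Nehari manifold `N_{λ,μ}`:
`⟨J'(u,v),(u,v)⟩ = P(u,v) − Q(u,v) − R(u,v) = 0`. -/
def InNehari (Ω : Set (Euc N)) (s : ℝ) (p : Euc N × Euc N → ℝ) (q α β a b c : Euc N → ℝ)
    (lam mu : ℝ) (u v : Euc N → ℝ) : Prop :=
  MemX0 Ω s p u ∧ MemX0 Ω s p v ∧ Nontriv u v ∧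
    Pfun s p u v - Qfun Ω q a b lam mu u v - Rfun Ω α β c u v = 0

/-- `N⁺_{λ,μ}`. -/
def InNPlus (Ω : Set (Euc N)) (s : ℝ) (p : Euc N × Euc N → ℝ) (q α β a b c : Euc N → ℝ)
    (lam mu : ℝ) (u v : Euc N → ℝ) : Prop :=
  InNehari Ω s p q α β a b c lam mu u v ∧ 0 < phiSecond Ω s p q α β a b c lam mu u v

/-- `N⁻_{λ,μ}`. -/
def InNMinus (Ω : Set (Euc N)) (s : ℝ) (p : Euc N × Euc N → ℝ) (q α β a b c : Euc N → ℝ)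
    (lam mu : ℝ) (u v : Euc N → ℝ) : Prop :=
  InNehari Ω s p q α β a b c lam mu u v ∧ phiSecond Ω s p q α β a b c lam mu u v < 0

/-- `N⁰_{λ,μ}`. -/
def InNZero (Ω : Set (Euc N)) (s : ℝ) (p : Euc N × Euc N → ℝ) (q α β a b c : Euc N → ℝ)
    (lam mu : ℝ) (u v : Euc N → ℝ) : Prop :=
  InNehari Ω s p q α β a b c lam mu u v ∧ phiSecond Ω s p q α β a b c lam mu u v = 0

/-- `(u,v)` is a weak solution of the system, i.e. `J'_{λ,μ}(u,v) = 0` in the dual of `E`. -/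
def IsWeakSolution (Ω : Set (Euc N)) (s : ℝ) (p : Euc N × Euc N → ℝ)
    (q α β a b c : Euc N → ℝ) (lam mu : ℝ) (u v : Euc N → ℝ) : Prop :=
  ∀ φ ψ : Euc N → ℝ, MemX0 Ω s p φ → MemX0 Ω s p ψ →
    ((∫ z : Euc N × Euc N,
        |u z.1 - u z.2| ^ (p z - 2) * (u z.1 - u z.2) * (φ z.1 - φ z.2) /
          ‖z.1 - z.2‖ ^ ((N : ℝ) + s * p z))
      + ∫ z : Euc N × Euc N,
          |v z.1 - v z.2| ^ (p z - 2) * (v z.1 - v z.2) * (ψ z.1 - ψ z.2) /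
            ‖z.1 - z.2‖ ^ ((N : ℝ) + s * p z))
    = (∫ x in Ω, (lam * a x * |u x| ^ (q x - 2) * u x * φ x
        + mu * b x * |v x| ^ (q x - 2) * v x * ψ x))
      + (∫ x in Ω, α x / (α x + β x) * c x * |u x| ^ (α x - 2) * u x * |v x| ^ β x * φ x)
      + ∫ x in Ω, β x / (α x + β x) * c x * |v x| ^ (α x - 2) * v x * |u x| ^ β x * ψ x

/-- the standing hypotheses: `Ω` a bounded domain, `s ∈ (0,1)`, (P1)–(P2) with `s p⁺ < N`,
and (A1)–(A4). -/
def HypAll (N : ℕ) (Ω : Set (Euc N)) (s : ℝ) (p : Euc N × Euc N → ℝ)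
    (q α β a b c : Euc N → ℝ) : Prop :=
  2 ≤ N ∧ IsOpen Ω ∧ Bornology.IsBounded Ω ∧ Ω.Nonempty ∧
  0 < s ∧ s < 1 ∧
  CPlus univ p ∧ (∀ x y : Euc N, p (x, y) = p (y, x)) ∧ s * supOn p univ < (N : ℝ) ∧
  CPlus (closure Ω) q ∧ CPlus (closure Ω) α ∧ CPlus (closure Ω) β ∧
  supOn q (closure Ω) < infOn p univ ∧
  supOn p univ < infOn α (closure Ω) + infOn β (closure Ω) ∧
  supOn α (closure Ω) + supOn β (closure Ω) < infOn (pstar N s p) (closure Ω) ∧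
  infOn p univ / (supOn α (closure Ω) + supOn β (closure Ω)) <
    (infOn p univ - supOn q (closure Ω)) /
        (supOn α (closure Ω) + supOn β (closure Ω) - supOn q (closure Ω)) *
      ((infOn α (closure Ω) + infOn β (closure Ω) - infOn q (closure Ω)) /
        (supOn p univ - infOn q (closure Ω))) ∧
  Measurable a ∧ Measurable b ∧ Measurable c ∧
  (∀ x, 0 ≤ a x) ∧ (∀ x, 0 ≤ b x) ∧ (∀ x, 0 ≤ c x) ∧
  MemVarLp Ω (fun x => (α x + β x) / (α x + β x - q x)) a ∧
  MemVarLp Ω (fun x => (α x + β x) / (α x + β x - q x)) b ∧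
  (∃ M : ℝ, ∀ x, c x ≤ M)

/-- the estimate `Q(u,v) ≤ C₁(λ+μ)·max{‖(u,v)‖^{q⁻},‖(u,v)‖^{q⁺}}`. -/
def QEstimate (Ω : Set (Euc N)) (s : ℝ) (p : Euc N × Euc N → ℝ) (q a b : Euc N → ℝ)
    (C₁ : ℝ) : Prop :=
  ∀ lam mu : ℝ, 0 < lam → 0 < mu → ∀ u v : Euc N → ℝ,
    MemX0 Ω s p u → MemX0 Ω s p v →
      Qfun Ω q a b lam mu u v ≤ C₁ * (lam + mu) *
        max (pairNorm s p u v ^ infOn q (closure Ω))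
          (pairNorm s p u v ^ supOn q (closure Ω))

/-- the estimate `R(u,v) ≤ C₂·max{‖(u,v)‖^{α⁻+β⁻},‖(u,v)‖^{α⁺+β⁺}}`. -/
def REstimate (Ω : Set (Euc N)) (s : ℝ) (p : Euc N × Euc N → ℝ) (α β c : Euc N → ℝ)
    (C₂ : ℝ) : Prop :=
  ∀ u v : Euc N → ℝ, MemX0 Ω s p u → MemX0 Ω s p v →
    Rfun Ω α β c u v ≤ C₂ *
      max (pairNorm s p u v ^ (infOn α (closure Ω) + infOn β (closure Ω)))
        (pairNorm s p u v ^ (supOn α (closure Ω) + supOn β (closure Ω)))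

/-- the threshold
`δ = (1/C₁)·[(α⁻+β⁻−p⁺)/(α⁻+β⁻−q⁻)]·[(p⁻−q⁺)/(C₂(α⁺+β⁺−q⁺))]^{(p⁺−q⁻)/(α⁻+β⁻−p⁺)}`. -/
def deltaConst (Ω : Set (Euc N)) (p : Euc N × Euc N → ℝ) (q α β : Euc N → ℝ)
    (C₁ C₂ : ℝ) : ℝ :=
  (1 / C₁) *
    ((infOn α (closure Ω) + infOn β (closure Ω) - supOn p univ) /
      (infOn α (closure Ω) + infOn β (closure Ω) - infOn q (closure Ω))) *
    ((infOn p univ - supOn q (closure Ω)) /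
        (C₂ * (supOn α (closure Ω) + supOn β (closure Ω) - supOn q (closure Ω)))) ^
      ((supOn p univ - infOn q (closure Ω)) /
        (infOn α (closure Ω) + infOn β (closure Ω) - supOn p univ))

/-- scaling `t·u`. -/
def scale (t : ℝ) (u : Euc N → ℝ) : Euc N → ℝ := fun x => t * u x

/-- weak convergence `u_m ⇀ u` in `X₀`, tested through the isometric embedding
`u ↦ (u(x)−u(y))` of `X₀` into `L^{p(x,y)}(dx dy/|x−y|^{N+sp(x,y)})`. -/
def WeakTendstoX0 (s : ℝ) (p : Euc N × Euc N → ℝ) (um : ℕ → Euc N → ℝ)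
    (u : Euc N → ℝ) : Prop :=
  ∀ g : Euc N × Euc N → ℝ, Measurable g →
    Integrable (fun z : Euc N × Euc N =>
      |g z| ^ (p z / (p z - 1)) / ‖z.1 - z.2‖ ^ ((N : ℝ) + s * p z)) →
    Tendsto (fun m => ∫ z : Euc N × Euc N,
        (um m z.1 - um m z.2) * g z / ‖z.1 - z.2‖ ^ ((N : ℝ) + s * p z)) atTop
      (𝓝 (∫ z : Euc N × Euc N, (u z.1 - u z.2) * g z / ‖z.1 - z.2‖ ^ ((N : ℝ) + s * p z)))

/-- The unscaled Gagliardo integrand, with values in `[0,∞]`. -/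
def gagliardoDensity (s : ℝ) (p : Euc N × Euc N → ℝ) (u : Euc N → ℝ) (z : Euc N × Euc N) :
    ENNReal :=
  ENNReal.ofReal (|u z.1 - u z.2| ^ p z / ‖z.1 - z.2‖ ^ ((N : ℝ) + s * p z))

/-- Functions in the unit ball of `X₀`, expressed through the modular. -/
structure InUnitBall (Ω : Set (Euc N)) (s : ℝ) (p : Euc N × Euc N → ℝ) (u : Euc N → ℝ) :
    Prop where
  measurable : Measurable u
  ae_zero : ∀ᵐ x ∂(volume : Measure (Euc N)), x ∉ Ω → u x = 0
  lintegral_le : ∫⁻ z, gagliardoDensity s p u z ≤ 1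

/-- The part of the standing hypotheses on the exponent `p` used in the estimates. -/
structure ExponentBounds (s : ℝ) (p : Euc N × Euc N → ℝ) : Prop where
  pos : 0 < s
  continuous : Continuous p
  one_lt : ∀ z, 1 < p z
  mul_lt : ∀ z, s * p z < N

lemma measurable_gagliardoDensity {s : ℝ} {p : Euc N × Euc N → ℝ} {u : Euc N → ℝ}
    (hp : Continuous p) (hu : Measurable u) : Measurable (gagliardoDensity s p u) := by
  have := hp.measurable
  unfold gagliardoDensity
  fun_prop

lemma volume_ball_eq (x : Euc N) {ρ : ℝ} (hρ : 0 < ρ) :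
    volume (Metric.ball x ρ) =
      ENNReal.ofReal (ρ ^ N) * volume (Metric.ball (0 : Euc N) 1) := by
  rw [Measure.addHaar_ball_of_pos _ _ hρ, finrank_euclideanSpace_fin]

lemma mul_volume_le_one {Ω : Set (Euc N)} {s : ℝ} {p : Euc N × Euc N → ℝ} {u : Euc N → ℝ}
    (hp : Continuous p) (hu : InUnitBall Ω s p u) {E : Set (Euc N)}
    (hE : MeasurableSet E) {K : ENNReal}
    (h : ∀ x ∈ E, K ≤ ∫⁻ y, gagliardoDensity s p u (x, y)) : K * volume E ≤ 1 := by
  calc K * volume E = ∫⁻ _ in E, K := by simp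
    _ ≤ ∫⁻ x in E, ∫⁻ y, gagliardoDensity s p u (x, y) := setLIntegral_mono' hE h
    _ ≤ ∫⁻ x, ∫⁻ y, gagliardoDensity s p u (x, y) := setLIntegral_le_lintegral _ _
    _ = ∫⁻ z, gagliardoDensity s p u z := by
      rw [Measure.volume_eq_prod, lintegral_prod]
      exact (measurable_gagliardoDensity hp hu.measurable).aemeasurable
    _ ≤ 1 := hu.lintegral_le

/-- Lower bound for the inner Gagliardo integral at `x` from a set `S` of points at distance at
most `ρ` on which `u` differs from `u x` by at least `t`. -/
lemma le_lintegral_gagliardoDensity {s : ℝ} {p : Euc N × Euc N → ℝ} {u : Euc N → ℝ}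
    {x : Euc N} {S : Set (Euc N)} (hS : MeasurableSet S) {K t ρ : ℝ} (ht : 0 < t)
    (hps : ∀ y ∈ S, 0 < p (x, y)) (hs : 0 < s)
    (hdist : ∀ y ∈ S, ‖x - y‖ ≤ ρ) (hu : ∀ᵐ y, y ∈ S → t ≤ |u x - u y|)
    (hK : ∀ y ∈ S, K ≤ t ^ p (x, y) / ρ ^ ((N : ℝ) + s * p (x, y))) :
    ENNReal.ofReal K * volume S ≤ ∫⁻ y, gagliardoDensity s p u (x, y) := by
  calc ENNReal.ofReal K * volume S = ∫⁻ _ in S, ENNReal.ofReal K := by simp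
    _ ≤ ∫⁻ y in S, gagliardoDensity s p u (x, y) := by
      apply lintegral_mono_ae
      rw [ae_restrict_iff' hS]
      filter_upwards [hu] with y hy hyS
      have hty := hy hyS
      have hxy : x ≠ y := by
        rintro rfl
        simp at hty
        linarith
      have hpos : 0 < ‖x - y‖ := norm_pos_iff.2 (sub_ne_zero.2 hxy)
      have hp0 := hps y hyS
      refine ENNReal.ofReal_le_ofReal ((hK y hyS).trans ?_)
      have h1 := hdist y hyS
      have : 0 ≤ (N : ℝ) + s * p (x, y) := by positivity
      dsimp only
      gcongr
    _ ≤ _ := setLIntegral_le_lintegral _ _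

/-- Weak-type Poincaré inequality. -/
lemma exists_weak_poincare {Ω : Set (Euc N)} {s : ℝ} {p : Euc N × Euc N → ℝ} (hN : 2 ≤ N)
    (hΩb : Bornology.IsBounded Ω) (hp : ExponentBounds s p) :
    ∃ A > 0, ∀ u, InUnitBall Ω s p u → ∀ t : ℝ, 1 ≤ t →
      volume {x | t < |u x|} ≤ ENNReal.ofReal (A * t ^ (-1 : ℝ)) := by
  have : NeZero N := ⟨by omega⟩
  obtain ⟨R, hR1, hR⟩ : ∃ R : ℝ, 1 ≤ R ∧ Ω ⊆ Metric.ball 0 R := by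
    obtain ⟨R, hR⟩ := hΩb.subset_ball (0 : Euc N)
    exact ⟨max R 1, le_max_right _ _, hR.trans (Metric.ball_subset_ball (le_max_left _ _))⟩
  set c : Euc N := EuclideanSpace.single 0 (2 * R) with hc
  have hcn : ‖c‖ = 2 * R := by
    rw [hc, PiLp.norm_single, Real.norm_of_nonneg (by positivity)]
  set S := Metric.ball c R with hSdef
  have hS0 : volume S ≠ 0 := (Metric.measure_ball_pos _ _ (by positivity)).ne'
  have hSt : volume S ≠ ⊤ := measure_ball_lt_top.ne
  set m := (volume S).toReal
  have hm : 0 < m := ENNReal.toReal_pos hS0 hSt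
  have hSd : ∀ y ∈ S, y ∉ Ω := by
    intro y hy hyΩ
    have h1 := hR hyΩ
    rw [mem_ball_zero_iff] at h1
    rw [hSdef, mem_ball_iff_norm] at hy
    have h2 : ‖c‖ ≤ ‖y‖ + ‖y - c‖ := by
      have := norm_sub_le y (y - c)
      simpa using this
    linarith
  refine ⟨(4 * R) ^ (2 * N : ℝ) / m, by positivity, fun u hu t ht => ?_⟩
  have hE : MeasurableSet ({x | t < |u x|} ∩ Metric.ball 0 R) :=
    (measurableSet_lt measurable_const hu.measurable.abs).inter measurableSet_ball
  have key := mul_volume_le_one (K := ENNReal.ofReal (t / (4 * R) ^ (2 * N : ℝ)) * volume S)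
    hp.continuous hu hE ?_
  · have hae : volume {x | t < |u x|} ≤ volume ({x | t < |u x|} ∩ Metric.ball 0 R) := by
      apply measure_mono_ae
      filter_upwards [hu.ae_zero] with x hx (htx : t < |u x|)
      refine ⟨htx, hR ?_⟩
      by_contra hxΩ
      rw [hx hxΩ] at htx
      simp at htx
      linarith
    refine hae.trans ?_
    rw [← ENNReal.ofReal_toReal hSt, ← ENNReal.ofReal_mul (by positivity)] at key
    have hpos : 0 < t / (4 * R) ^ (2 * N : ℝ) * m := by positivity
    rw [mul_comm, ← ENNReal.le_div_iff_mul_le (by simp) (by simp)] at key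
    refine key.trans (le_of_eq ?_)
    rw [← ENNReal.ofReal_one, ← ENNReal.ofReal_div_of_pos hpos, Real.rpow_neg_one]
    congr 1
    field_simp
  · rintro x ⟨hxt, hxR⟩
    refine le_lintegral_gagliardoDensity measurableSet_ball (t := t) (ρ := 4 * R) (by linarith)
      (fun y _ => by linarith [hp.one_lt (x, y)]) hp.pos ?_ ?_ ?_
    · intro y hy
      rw [mem_ball_zero_iff] at hxR
      rw [mem_ball_iff_norm] at hy
      have h2 : ‖y‖ ≤ ‖c‖ + ‖y - c‖ := by
        have := norm_add_le c (y - c)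
        simpa using this
      have := norm_sub_le x y
      linarith
    · filter_upwards [hu.ae_zero] with y hy hyS
      rw [hy (hSd y hyS), sub_zero]
      exact le_of_lt hxt
    · intro y hy
      have h1 := hp.one_lt (x, y)
      have h2 := hp.mul_lt (x, y)
      have : t ≤ t ^ p (x, y) := by
        simpa using Real.rpow_le_rpow_of_exponent_le ht h1.le
      gcongr
      · linarith
      · linarith

/-- Uniform polynomial decay, with exponent `θ`, of the distribution function on the ball
`B(x₀,δ)` over the unit ball of `X₀`. -/
def HasDecay (Ω : Set (Euc N)) (s : ℝ) (p : Euc N × Euc N → ℝ) (x₀ : Euc N) (δ θ : ℝ) : Prop :=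
  ∃ A > 0, ∃ l ≥ 1, ∀ u, InUnitBall Ω s p u → ∀ t : ℝ, l ≤ t →
    volume ({x | t < |u x|} ∩ Metric.ball x₀ δ) ≤ ENNReal.ofReal (A * t ^ (-θ))

/-- Self-improvement of the decay exponent on a smaller ball. -/
lemma HasDecay.improve {Ω : Set (Euc N)} {s : ℝ} {p : Euc N × Euc N → ℝ} (hN : 2 ≤ N)
    (hp : ExponentBounds s p) {x₀ : Euc N} {δ δ' θ q : ℝ} (hθ : 0 < θ) (hδ : δ' < δ)
    (hqp : ∀ x ∈ Metric.ball x₀ δ, ∀ y ∈ Metric.ball x₀ δ, q ≤ p (x, y))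
    (h : HasDecay Ω s p x₀ δ θ) : HasDecay Ω s p x₀ δ' (q + s * q / N * θ) := by
  obtain ⟨A, hA, l, hl, h⟩ := h
  have hN0 : (0 : ℝ) < N := by positivity
  have hs := hp.pos
  have hb0 : volume (Metric.ball (0 : Euc N) 1) ≠ 0 :=
    (Metric.measure_ball_pos _ _ one_pos).ne'
  have hbt : volume (Metric.ball (0 : Euc N) 1) ≠ ⊤ := measure_ball_lt_top.ne
  set b := (volume (Metric.ball (0 : Euc N) 1)).toReal with hb
  have hbpos : 0 < b := ENNReal.toReal_pos hb0 hbt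
  set c := (2 * A / b) ^ ((N : ℝ)⁻¹) with hc
  have hcpos : 0 < c := by positivity
  have hcN : c ^ N = 2 * A / b := by
    rw [hc, Real.rpow_inv_natCast_pow (by positivity) (by omega)]
  have hlim : Tendsto (fun τ : ℝ => c * τ ^ (-(θ / N))) atTop (𝓝 0) := by
    simpa using (tendsto_rpow_neg_atTop (div_pos hθ hN0)).const_mul c
  obtain ⟨τ₀, hτ₀⟩ := eventually_atTop.1
    (hlim.eventually (ge_mem_nhds (lt_min one_pos (sub_pos.2 hδ))))
  refine ⟨c ^ (N + s * q) / A * 2 ^ (q + s * q / N * θ), by positivity, 2 * max l τ₀, ?_, ?_⟩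
  · have := le_max_left l τ₀
    linarith
  intro u hu t ht
  obtain ⟨τ, rfl⟩ : ∃ τ, t = 2 * τ := ⟨t / 2, by ring⟩
  have hlτ : l ≤ τ := by linarith [le_max_left l τ₀]
  have hτ1 : 1 ≤ τ := hl.trans hlτ
  have hτpos : 0 < τ := by linarith
  set ρ := c * τ ^ (-(θ / N)) with hρ
  have hρpos : 0 < ρ := by positivity
  obtain ⟨hρ1, hρδ⟩ := le_min_iff.1 (hτ₀ τ (by linarith [le_max_right l τ₀]))
  have hρN : ρ ^ N = 2 * A / b * τ ^ (-θ) := by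
    rw [hρ, mul_pow, hcN, ← Real.rpow_mul_natCast hτpos.le]
    congr 2
    field_simp
  set K := τ ^ q / ρ ^ ((N : ℝ) + s * q) with hK
  have hKpos : 0 < K := by positivity
  have hmeas (t : ℝ) : MeasurableSet {x | t < |u x|} :=
    measurableSet_lt measurable_const hu.measurable.abs
  have key := mul_volume_le_one (K := ENNReal.ofReal (K * (A * τ ^ (-θ)))) hp.continuous hu
    ((hmeas (2 * τ)).inter (measurableSet_ball (x := x₀) (ε := δ'))) ?_
  · have hpos : 0 < K * (A * τ ^ (-θ)) := by positivity
    rw [mul_comm, ← ENNReal.le_div_iff_mul_le (by simp [hpos]) (by simp)] at key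
    refine key.trans (le_of_eq ?_)
    rw [← ENNReal.ofReal_one, ← ENNReal.ofReal_div_of_pos hpos]
    congr 1
    have e1 : ρ ^ ((N : ℝ) + s * q) =
        c ^ (N + s * q) * (τ ^ (-θ) * τ ^ (-(s * q / N * θ))) := by
      rw [hρ, Real.mul_rpow hcpos.le (by positivity), ← Real.rpow_mul hτpos.le,
        ← Real.rpow_add hτpos]
      congr 2
      field_simp
      ring
    rw [hK, e1, Real.mul_rpow (by norm_num) hτpos.le, Real.rpow_neg (by norm_num : (0 : ℝ) ≤ 2),
      neg_add, Real.rpow_add hτpos, Real.rpow_neg hτpos.le q]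
    field_simp
  · rintro x ⟨hxt : 2 * τ < |u x|, hxδ⟩
    have hball : Metric.ball x ρ ⊆ Metric.ball x₀ δ := by
      apply Metric.ball_subset_ball'
      rw [Metric.mem_ball] at hxδ
      linarith
    have hxδ' : x ∈ Metric.ball x₀ δ := hball (Metric.mem_ball_self hρpos)
    set S := Metric.ball x ρ \ {y | τ < |u y|} with hS
    have hSm : MeasurableSet S := measurableSet_ball.diff (hmeas τ)
    have hvol : ENNReal.ofReal (A * τ ^ (-θ)) ≤ volume S := by
      have h1 : volume (Metric.ball x ρ) ≤
          volume S + volume ({x | τ < |u x|} ∩ Metric.ball x₀ δ) := by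
        refine (measure_mono fun y hy => ?_).trans (measure_union_le _ _)
        by_cases hyτ : τ < |u y|
        · exact Or.inr ⟨hyτ, hball hy⟩
        · exact Or.inl ⟨hy, hyτ⟩
      have h2 : volume (Metric.ball x ρ) =
          ENNReal.ofReal (A * τ ^ (-θ)) + ENNReal.ofReal (A * τ ^ (-θ)) := by
        rw [volume_ball_eq x hρpos, ← ENNReal.ofReal_toReal hbt,
          ← ENNReal.ofReal_mul (by positivity), ← ENNReal.ofReal_add (by positivity)
          (by positivity), hρN]
        congr 1
        rw [← hb]
        field_simp
        ring
      rw [h2] at h1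
      exact ENNReal.le_of_add_le_add_right ENNReal.ofReal_ne_top
        (h1.trans (by gcongr; exact h u hu τ hlτ))
    rw [ENNReal.ofReal_mul hKpos.le]
    refine (mul_le_mul_right hvol _).trans ?_
    refine le_lintegral_gagliardoDensity hSm (t := τ) (ρ := ρ) hτpos
      (fun y _ => by linarith [hp.one_lt (x, y)]) hs ?_ (ae_of_all _ ?_) ?_
    · intro y hy
      have := hy.1
      rw [mem_ball_iff_norm'] at this
      exact this.le
    · intro y hy
      have h1 : |u y| ≤ τ := not_lt.1 hy.2
      have := abs_sub_abs_le_abs_sub (u x) (u y)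
      linarith
    · intro y hy
      have hqy := hqp x hxδ' y (hball hy.1)
      have h1 : ρ ^ ((N : ℝ) + s * p (x, y)) ≤ ρ ^ ((N : ℝ) + s * q) :=
        Real.rpow_le_rpow_of_exponent_ge hρpos hρ1 (by gcongr)
      have h2 : τ ^ q ≤ τ ^ p (x, y) := Real.rpow_le_rpow_of_exponent_le hτ1 hqy
      rw [hK]
      gcongr

/-- The decay exponent reaches every subcritical value. -/
lemma exists_hasDecay {Ω : Set (Euc N)} {s : ℝ} {p : Euc N × Euc N → ℝ} (hN : 2 ≤ N)
    (hΩb : Bornology.IsBounded Ω) (hp : ExponentBounds s p) {x₀ : Euc N} {δ q R : ℝ}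
    (hδ : 0 < δ) (hq : 0 < q) (hsq : s * q < N)
    (hqp : ∀ x ∈ Metric.ball x₀ δ, ∀ y ∈ Metric.ball x₀ δ, q ≤ p (x, y))
    (hR : R < N * q / (N - s * q)) :
    ∃ θ > R, HasDecay Ω s p x₀ (δ / 2) θ := by
  have hs := hp.pos
  have hN0 : (0 : ℝ) < N := by positivity
  set κ := s * q / N with hκ
  have hκ0 : 0 < κ := by positivity
  have hκ1 : κ < 1 := by rw [hκ, div_lt_one hN0]; exact hsq
  set f : ℝ → ℝ := fun θ => q + κ * θ with hf
  set θs := N * q / (N - s * q) with hθs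
  have hfix : f θs = θs := by
    have : (N : ℝ) - s * q ≠ 0 := by linarith
    simp only [hf, hθs, hκ]
    rw [eq_div_iff this, add_mul, mul_assoc (s * q / N), div_mul_cancel₀ _ this]
    field_simp
    ring
  have hiter (n : ℕ) : f^[n] 1 = θs - κ ^ n * (θs - 1) := by
    induction n with
    | zero => simp
    | succ n ih =>
      rw [Function.iterate_succ_apply', ih, pow_succ]
      simp only [hf] at hfix ⊢
      linear_combination hfix
  have hpos (n : ℕ) : 0 < f^[n] 1 := by
    induction n with
    | zero => simp
    | succ n ih =>
      rw [Function.iterate_succ_apply']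
      positivity
  have hdecay (n : ℕ) : ∀ δ' < δ, HasDecay Ω s p x₀ δ' (f^[n] 1) := by
    induction n with
    | zero =>
      intro δ' _
      obtain ⟨A, hA, h⟩ := exists_weak_poincare hN hΩb hp
      exact ⟨A, hA, 1, le_rfl, fun u hu t ht =>
        (measure_mono inter_subset_left).trans (h u hu t ht)⟩
    | succ n ih =>
      intro δ' hδ'
      rw [Function.iterate_succ_apply']
      have hsub : Metric.ball x₀ ((δ + δ') / 2) ⊆ Metric.ball x₀ δ :=
        Metric.ball_subset_ball (by linarith)
      exact (ih ((δ + δ') / 2) (by linarith)).improve hN hp (hpos n) (by linarith)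
        fun x hx y hy => hqp x (hsub hx) y (hsub hy)
  have hlim : Tendsto (fun n => f^[n] 1) atTop (𝓝 θs) := by
    simp only [hiter]
    simpa using ((tendsto_pow_atTop_nhds_zero_of_lt_one hκ0.le hκ1).mul_const
      (θs - 1)).const_sub θs
  obtain ⟨n, hn⟩ := (hlim.eventually (lt_mem_nhds hR)).exists
  exact ⟨_, hn, hdecay n _ (by linarith)⟩

lemma lintegral_rpow_le_of_hasDecay {Ω : Set (Euc N)} {s : ℝ} {p : Euc N × Euc N → ℝ}
    {x₀ : Euc N} {δ θ R : ℝ} (hR : 0 < R) (hθ : R < θ) (h : HasDecay Ω s p x₀ δ θ) :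
    ∃ C : NNReal, ∀ u, InUnitBall Ω s p u →
      ∫⁻ x in Metric.ball x₀ δ, ENNReal.ofReal (|u x| ^ R) ≤ C := by
  obtain ⟨A, hA, l, hl, h⟩ := h
  have hl0 : 0 < l := by linarith
  set V := volume (Metric.ball x₀ δ) with hV
  have hVt : V ≠ ⊤ := measure_ball_lt_top.ne
  set I₁ := ∫⁻ t in Ioc 0 l, ENNReal.ofReal (t ^ (R - 1))
  set I₂ := ∫⁻ t in Ioi l, ENNReal.ofReal (A * t ^ (R - 1 - θ))
  have hI₁ : I₁ ≠ ⊤ := by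
    have : IntegrableOn (fun t : ℝ => t ^ (R - 1)) (Ioc 0 l) := by
      rw [← intervalIntegrable_iff_integrableOn_Ioc_of_le hl0.le]
      exact intervalIntegral.intervalIntegrable_rpow' (by linarith)
    exact this.lintegral_lt_top.ne
  have hI₂ : I₂ ≠ ⊤ := by
    have : IntegrableOn (fun t : ℝ => A * t ^ (R - 1 - θ)) (Ioi l) :=
      (integrableOn_Ioi_rpow_of_lt (by linarith) hl0).const_mul A
    exact this.lintegral_lt_top.ne
  refine ⟨(ENNReal.ofReal R * (V * I₁ + I₂)).toNNReal, fun u hu => ?_⟩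
  rw [ENNReal.coe_toNNReal (by finiteness),
    lintegral_rpow_eq_lintegral_meas_lt_mul _ (ae_of_all _ fun x => abs_nonneg _)
    hu.measurable.abs.aemeasurable hR]
  gcongr
  rw [← Ioc_union_Ioi_eq_Ioi hl0.le, lintegral_union measurableSet_Ioi (by simp)]
  gcongr
  · rw [← lintegral_const_mul' _ _ hVt]
    refine lintegral_mono fun t => ?_
    gcongr
    simpa using measure_mono (μ := volume.restrict (Metric.ball x₀ δ)) (subset_univ _)
  · refine setLIntegral_mono' measurableSet_Ioi fun t (ht : l < t) => ?_
    have ht0 : 0 < t := by linarith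
    rw [Measure.restrict_apply (measurableSet_lt measurable_const hu.measurable.abs)]
    refine (mul_le_mul_left (h u hu t ht.le) _).trans (le_of_eq ?_)
    rw [← ENNReal.ofReal_mul (by positivity), mul_assoc, ← Real.rpow_add ht0]
    congr 3
    ring

lemma exists_lintegral_rpow_le {Ω : Set (Euc N)} {s : ℝ} {p : Euc N × Euc N → ℝ} (hN : 2 ≤ N)
    (hΩo : IsOpen Ω) (hΩb : Bornology.IsBounded Ω) (hp : ExponentBounds s p)
    {r : Euc N → ℝ} (hrc : ContinuousOn r (closure Ω)) (hr0 : ∀ x ∈ closure Ω, 0 < r x)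
    (hr : ∀ x ∈ closure Ω, r x < pstar N s p x) :
    ∃ C : NNReal, ∀ u, InUnitBall Ω s p u →
      ∫⁻ x in Ω, ENNReal.ofReal (|u x| ^ r x) ≤ C := by
  have hs := hp.pos
  suffices H : ∃ C : NNReal, ∀ u, InUnitBall Ω s p u →
      ∫⁻ x in closure Ω ∩ Ω, ENNReal.ofReal (|u x| ^ r x) ≤ C by
    rwa [inter_eq_right.2 subset_closure] at H
  refine hΩb.isCompact_closure.induction_on (p := fun S => ∃ C : NNReal, ∀ u,
    InUnitBall Ω s p u → ∫⁻ x in S ∩ Ω, ENNReal.ofReal (|u x| ^ r x) ≤ C) ⟨0, by simp⟩ ?_ ?_ ?_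
  · rintro S T hST ⟨C, hC⟩
    exact ⟨C, fun u hu => (lintegral_mono_set (inter_subset_inter_left _ hST)).trans (hC u hu)⟩
  · rintro S T ⟨C, hC⟩ ⟨D, hD⟩
    refine ⟨C + D, fun u hu => ?_⟩
    rw [union_inter_distrib_right, ENNReal.coe_add]
    exact (lintegral_union_le _ _ _).trans (add_le_add (hC u hu) (hD u hu))
  · intro x₀ hx₀
    have hd0 : 0 < (N : ℝ) - s * p (x₀, x₀) := sub_pos.2 (hp.mul_lt _)
    obtain ⟨R, hrR, hR⟩ := exists_between (hr x₀ hx₀)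
    obtain ⟨q, ⟨hRq, hq0, hsq⟩, hqp⟩ : ∃ q, (R < N * q / (N - s * q) ∧ 0 < q ∧ s * q < N) ∧
        q < p (x₀, x₀) := by
      have hev : ∀ᶠ q in 𝓝 (p (x₀, x₀)), R < N * q / (N - s * q) ∧ 0 < q ∧ s * q < N := by
        refine Filter.Eventually.and ?_ (.and (lt_mem_nhds (by linarith [hp.one_lt (x₀, x₀)])) ?_)
        · have : ContinuousAt (fun q : ℝ => (N : ℝ) * q / (N - s * q)) (p (x₀, x₀)) :=
            ContinuousAt.div (by fun_prop) (by fun_prop) hd0.ne'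
          exact this.eventually (lt_mem_nhds hR)
        · have : ContinuousAt (fun q : ℝ => s * q) (p (x₀, x₀)) := by fun_prop
          exact this.eventually (gt_mem_nhds (hp.mul_lt _))
      exact ((hev.filter_mono nhdsWithin_le_nhds).and
        (self_mem_nhdsWithin : Iio (p (x₀, x₀)) ∈ 𝓝[<] _)).exists
    have hpev : ∀ᶠ z in 𝓝 (x₀, x₀), q < p z := hp.continuous.continuousAt.eventually
      (lt_mem_nhds hqp)
    obtain ⟨δ, hδ, hδp⟩ := Metric.eventually_nhds_iff_ball.1 hpev
    obtain ⟨θ, hθ, hdec⟩ := exists_hasDecay (x₀ := x₀) hN hΩb hp hδ hq0 hsq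
      (fun x hx y hy => (hδp (x, y) (by
        rw [← ball_prod_same]
        exact ⟨hx, hy⟩)).le) hRq
    have hR0 : 0 < R := (hr0 x₀ hx₀).trans hrR
    obtain ⟨C, hC⟩ := lintegral_rpow_le_of_hasDecay hR0 hθ hdec
    have hrev : ∀ᶠ x in 𝓝[closure Ω] x₀, r x < R := (hrc x₀ hx₀).eventually (gt_mem_nhds hrR)
    obtain ⟨U, hUo, hxU, hU⟩ := mem_nhdsWithin.1 hrev
    have hVt : volume (Metric.ball x₀ (δ / 2)) ≠ ⊤ := measure_ball_lt_top.ne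
    refine ⟨Metric.ball x₀ (δ / 2) ∩ U, mem_nhdsWithin_of_mem_nhds (inter_mem
      (Metric.ball_mem_nhds _ (by positivity)) (hUo.mem_nhds hxU)),
      (volume (Metric.ball x₀ (δ / 2))).toNNReal + C, fun u hu => ?_⟩
    calc ∫⁻ x in Metric.ball x₀ (δ / 2) ∩ U ∩ Ω, ENNReal.ofReal (|u x| ^ r x)
        ≤ ∫⁻ x in Metric.ball x₀ (δ / 2) ∩ U ∩ Ω, (1 + ENNReal.ofReal (|u x| ^ R)) := by
          refine setLIntegral_mono' ((measurableSet_ball.inter hUo.measurableSet).inter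
            hΩo.measurableSet) fun x hx => ?_
          have hxc := subset_closure hx.2
          rw [← ENNReal.ofReal_one, ← ENNReal.ofReal_add zero_le_one (by positivity)]
          refine ENNReal.ofReal_le_ofReal ?_
          rcases le_total (|u x|) 1 with h | h
          · have := Real.rpow_le_one (abs_nonneg _) h (hr0 x hxc).le
            have : 0 ≤ |u x| ^ R := by positivity
            linarith
          · have : |u x| ^ r x ≤ |u x| ^ R :=
              Real.rpow_le_rpow_of_exponent_le h (hU ⟨hx.1.2, hxc⟩ : r x < R).le
            linarith
      _ ≤ ∫⁻ x in Metric.ball x₀ (δ / 2), (1 + ENNReal.ofReal (|u x| ^ R)) :=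
          lintegral_mono_set fun x hx => hx.1.1
      _ = volume (Metric.ball x₀ (δ / 2)) +
          ∫⁻ x in Metric.ball x₀ (δ / 2), ENNReal.ofReal (|u x| ^ R) := by
          rw [lintegral_add_left measurable_const]
          simp
      _ ≤ _ := by
          rw [ENNReal.coe_add, ENNReal.coe_toNNReal hVt]
          gcongr
          exact hC u hu

lemma enorm_sub_le_gagliardoDensity {s : ℝ} {p : Euc N × Euc N → ℝ} (hp : ExponentBounds s p)
    (u : Euc N → ℝ) {x y : Euc N} {d : ℝ} (hxy : ‖x - y‖ ≤ d) :
    ‖u x - u y‖ₑ ≤ ENNReal.ofReal (d ^ s) +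
      ENNReal.ofReal (d ^ (N + s)) * gagliardoDensity s p u (x, y) := by
  have hs := hp.pos
  rcases eq_or_ne x y with rfl | hne
  · simp
  have h0 : 0 < ‖x - y‖ := norm_pos_iff.2 (sub_ne_zero.2 hne)
  have hd : 0 < d := h0.trans_le hxy
  rw [gagliardoDensity, ← ENNReal.ofReal_mul (by positivity),
    ← ENNReal.ofReal_add (by positivity) (by positivity), Real.enorm_eq_ofReal_abs]
  refine ENNReal.ofReal_le_ofReal ?_
  dsimp only
  have hp1 := hp.one_lt (x, y)
  set P := p (x, y)
  set a := |u x - u y|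
  set h := ‖x - y‖
  have ha : 0 ≤ a := abs_nonneg _
  have e : a ^ P / h ^ ((N : ℝ) + s * P) = (a / h ^ s) ^ P / h ^ (N : ℝ) := by
    rw [Real.div_rpow ha (by positivity), ← Real.rpow_mul h0.le, Real.rpow_add h0]
    field_simp
  have e2 : a / h ^ s ≤ 1 + (a / h ^ s) ^ P := by
    have hF : 0 ≤ a / h ^ s := by positivity
    rcases le_total (a / h ^ s) 1 with h1 | h1
    · have : 0 ≤ (a / h ^ s) ^ P := by positivity
      linarith
    · have := Real.rpow_le_rpow_of_exponent_le h1 hp1.le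
      rw [Real.rpow_one] at this
      linarith
  calc a = h ^ s * (a / h ^ s) := by field_simp
    _ ≤ h ^ s * (1 + (a / h ^ s) ^ P) := by gcongr
    _ = h ^ s + h ^ (N + s) * ((a / h ^ s) ^ P / h ^ (N : ℝ)) := by
      rw [Real.rpow_add h0]
      field_simp
    _ ≤ d ^ s + d ^ (N + s) * ((a / h ^ s) ^ P / h ^ (N : ℝ)) := by gcongr
    _ = _ := by rw [e]

lemma lintegral_oscillation_le {Ω : Set (Euc N)} {s : ℝ} {p : Euc N × Euc N → ℝ}
    (hp : ExponentBounds s p) {u : Euc N → ℝ} (hu : InUnitBall Ω s p u) {d : ℝ} (hd : 0 < d) :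
    ∫⁻ x in Ω, ∫⁻ y in Metric.ball x d, ‖u x - u y‖ₑ ≤
      ENNReal.ofReal (d ^ (N + s)) * (volume (Metric.ball (0 : Euc N) 1) * volume Ω + 1) := by
  have hm := measurable_gagliardoDensity (s := s) hp.continuous hu.measurable
  calc ∫⁻ x in Ω, ∫⁻ y in Metric.ball x d, ‖u x - u y‖ₑ
      ≤ ∫⁻ x in Ω, (ENNReal.ofReal (d ^ (N + s)) * volume (Metric.ball (0 : Euc N) 1) +
          ENNReal.ofReal (d ^ (N + s)) * ∫⁻ y, gagliardoDensity s p u (x, y)) := by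
        refine lintegral_mono fun x => ?_
        calc ∫⁻ y in Metric.ball x d, ‖u x - u y‖ₑ
            ≤ ∫⁻ y in Metric.ball x d, (ENNReal.ofReal (d ^ s) +
                ENNReal.ofReal (d ^ (N + s)) * gagliardoDensity s p u (x, y)) :=
              setLIntegral_mono' measurableSet_ball fun y hy =>
                enorm_sub_le_gagliardoDensity hp u (mem_ball_iff_norm'.1 hy).le
          _ = ENNReal.ofReal (d ^ (N + s)) * volume (Metric.ball (0 : Euc N) 1) +
                ENNReal.ofReal (d ^ (N + s)) *
                  ∫⁻ y in Metric.ball x d, gagliardoDensity s p u (x, y) := by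
              rw [lintegral_add_left measurable_const,
                lintegral_const_mul' _ _ ENNReal.ofReal_ne_top, setLIntegral_const,
                volume_ball_eq x hd, ← mul_assoc, ← ENNReal.ofReal_mul (by positivity),
                Real.rpow_add hd, Real.rpow_natCast, mul_comm (d ^ s)]
          _ ≤ _ := add_le_add le_rfl (mul_le_mul' le_rfl (setLIntegral_le_lintegral _ _))
    _ = ENNReal.ofReal (d ^ (N + s)) * (volume (Metric.ball (0 : Euc N) 1) * volume Ω +
          ∫⁻ x in Ω, ∫⁻ y, gagliardoDensity s p u (x, y)) := by
        rw [lintegral_add_left measurable_const, lintegral_const_mul' _ _ ENNReal.ofReal_ne_top,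
          lintegral_const_mul' _ _ ENNReal.ofReal_ne_top, setLIntegral_const, mul_add]
    _ ≤ _ := by
        gcongr
        refine (setLIntegral_le_lintegral _ _).trans (le_trans (le_of_eq ?_) hu.lintegral_le)
        rw [Measure.volume_eq_prod, lintegral_prod _ hm.aemeasurable]

lemma enorm_mul_sub_integral_ball_le {u : Euc N → ℝ} (hu : Integrable u) {x e : Euc N} {d : ℝ}
    (hx : x ∈ Metric.ball e d) :
    ‖(volume (Metric.ball e d)).toReal * u x - ∫ y in Metric.ball e d, u y‖ₑ ≤
      ∫⁻ y in Metric.ball x (2 * d), ‖u x - u y‖ₑ := by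
  have h1 : (volume (Metric.ball e d)).toReal * u x - ∫ y in Metric.ball e d, u y =
      ∫ y in Metric.ball e d, (u x - u y) := by
    have hc : IntegrableOn (fun _ => u x) (Metric.ball e d) :=
      integrableOn_const measure_ball_lt_top.ne
    rw [integral_sub hc hu.integrableOn]
    simp [Measure.real]
  rw [h1]
  refine (enorm_integral_le_lintegral_enorm _).trans (lintegral_mono_set ?_)
  apply Metric.ball_subset_ball'
  rw [Metric.mem_ball, dist_comm] at hx
  linarith

/-- `L¹(Ω)` distance of two functions in terms of their integrals over a finite cover of `Ω`
by balls of radius `d`. -/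
lemma exists_lintegral_enorm_sub_le {Ω : Set (Euc N)} {s : ℝ} {p : Euc N × Euc N → ℝ}
    (hΩo : IsOpen Ω) (hΩb : Bornology.IsBounded Ω) (hp : ExponentBounds s p) :
    ∃ B : NNReal, ∀ d : ℝ, 0 < d → ∃ D : NNReal, ∀ (I : Finset ℕ) (e : ℕ → Euc N),
      Ω ⊆ ⋃ i ∈ I, Metric.ball (e i) d → ∀ u v, InUnitBall Ω s p u → InUnitBall Ω s p v →
      Integrable u → Integrable v → ∫⁻ x in Ω, ‖u x - v x‖ₑ ≤ B * ENNReal.ofReal (d ^ s) +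
        D * ∑ i ∈ I, ‖(∫ y in Metric.ball (e i) d, u y) - ∫ y in Metric.ball (e i) d, v y‖ₑ := by
  have hs := hp.pos
  have hΩt : volume Ω ≠ ⊤ := hΩb.measure_lt_top.ne
  have hb0 : volume (Metric.ball (0 : Euc N) 1) ≠ 0 := (Metric.measure_ball_pos _ _ one_pos).ne'
  have hbt : volume (Metric.ball (0 : Euc N) 1) ≠ ⊤ := measure_ball_lt_top.ne
  set b := volume (Metric.ball (0 : Euc N) 1) with hb
  set B := 2 * ENNReal.ofReal (2 ^ (N + s)) * (b * volume Ω + 1) / b with hB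
  have hBt : B ≠ ⊤ := by
    rw [hB]
    finiteness
  refine ⟨B.toNNReal, fun d hd => ?_⟩
  set V := ENNReal.ofReal (d ^ N) * b with hV
  have hV0 : V ≠ 0 := by simp [hV, hb0, hd]
  have hVt : V ≠ ⊤ := by finiteness
  refine ⟨(volume Ω / V).toNNReal, fun I c hI u v hu hv hui hvi => ?_⟩
  have hVe (e : Euc N) : ENNReal.ofReal (volume (Metric.ball e d)).toReal = V := by
    rw [ENNReal.ofReal_toReal measure_ball_lt_top.ne, volume_ball_eq e hd]
  set Sg := ∑ i ∈ I, ‖(∫ y in Metric.ball (c i) d, u y) - ∫ y in Metric.ball (c i) d, v y‖ₑ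
  have hTm : ∀ w, InUnitBall Ω s p w →
      Measurable fun x => ∫⁻ y in Metric.ball x (2 * d), ‖w x - w y‖ₑ := by
    intro w hw
    have hw' := hw.measurable
    have e (x : Euc N) : ∫⁻ y in Metric.ball x (2 * d), ‖w x - w y‖ₑ =
        ∫⁻ y, {z : Euc N × Euc N | dist z.2 z.1 < 2 * d}.indicator
          (fun z => ‖w z.1 - w z.2‖ₑ) (x, y) := by
      rw [← lintegral_indicator measurableSet_ball]
      rfl
    simp only [e]
    refine Measurable.lintegral_prod_right' (Measurable.indicator (by fun_prop) ?_)
    exact measurableSet_lt (by fun_prop) measurable_const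
  have hpt : ∀ x ∈ Ω, V * ‖u x - v x‖ₑ ≤ (∫⁻ y in Metric.ball x (2 * d), ‖u x - u y‖ₑ) +
      (∫⁻ y in Metric.ball x (2 * d), ‖v x - v y‖ₑ) + Sg := by
    intro x hx
    obtain ⟨i, hiI, hxe⟩ := mem_iUnion₂.1 (hI hx)
    have h1 := enorm_mul_sub_integral_ball_le hui hxe
    have h2 := enorm_mul_sub_integral_ball_le hvi hxe
    have h3 : ‖(∫ y in Metric.ball (c i) d, u y) - ∫ y in Metric.ball (c i) d, v y‖ₑ ≤ Sg :=
      Finset.single_le_sum (f := fun i => ‖(∫ y in Metric.ball (c i) d, u y) -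
        ∫ y in Metric.ball (c i) d, v y‖ₑ) (fun _ _ => zero_le) hiI
    set m := (volume (Metric.ball (c i) d)).toReal
    have h4 : V * ‖u x - v x‖ₑ = ‖m * (u x - v x)‖ₑ := by
      rw [enorm_mul, ← hVe (c i), Real.enorm_of_nonneg ENNReal.toReal_nonneg]
    rw [h4]
    have h5 : m * (u x - v x) = (m * u x - ∫ y in Metric.ball (c i) d, u y) -
        (m * v x - ∫ y in Metric.ball (c i) d, v y) +
        ((∫ y in Metric.ball (c i) d, u y) - ∫ y in Metric.ball (c i) d, v y) := by ring
    rw [h5]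
    refine (enorm_add_le _ _).trans (add_le_add ((enorm_sub_le).trans (add_le_add h1 h2)) h3)
  have hint : V * ∫⁻ x in Ω, ‖u x - v x‖ₑ ≤
      2 * (ENNReal.ofReal ((2 * d) ^ (N + s)) * (b * volume Ω + 1)) + volume Ω * Sg := by
    rw [← lintegral_const_mul' _ _ hVt]
    refine (setLIntegral_mono' hΩo.measurableSet hpt).trans ?_
    rw [lintegral_add_right _ measurable_const, lintegral_add_left (hTm u hu),
      setLIntegral_const, mul_comm Sg, two_mul (ENNReal.ofReal _ * _)]
    have hd2 : 0 < 2 * d := by positivity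
    exact add_le_add (add_le_add (lintegral_oscillation_le hp hu hd2)
      (lintegral_oscillation_le hp hv hd2)) le_rfl
  rw [mul_comm, ← ENNReal.le_div_iff_mul_le (.inl hV0) (.inl hVt), ENNReal.add_div] at hint
  refine hint.trans (le_of_eq ?_)
  rw [ENNReal.coe_toNNReal hBt, ENNReal.coe_toNNReal (by finiteness)]
  congr 1
  · have : (2 * d) ^ ((N : ℝ) + s) = 2 ^ ((N : ℝ) + s) * d ^ s * d ^ N := by
      rw [Real.mul_rpow (by norm_num) hd.le, Real.rpow_add hd, Real.rpow_natCast]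
      ring
    rw [this, ENNReal.ofReal_mul (by positivity), ENNReal.ofReal_mul (by positivity), hB, hV]
    have hc : ENNReal.ofReal (d ^ N) ≠ 0 := by simp [hd]
    have e (X Y Z W : ENNReal) : 2 * (X * Y * Z * W) = Z * (2 * X * W * Y) := by ring
    rw [e, ENNReal.mul_div_mul_left _ _ hc ENNReal.ofReal_ne_top, ENNReal.mul_div_right_comm]
  · simp only [div_eq_mul_inv]
    ring

lemma exists_subseq_ae_tendsto {Ω : Set (Euc N)} {s : ℝ} {p : Euc N × Euc N → ℝ}
    (hΩo : IsOpen Ω) (hΩb : Bornology.IsBounded Ω) (hp : ExponentBounds s p) {C : NNReal}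
    {v : ℕ → Euc N → ℝ} (hv : ∀ m, InUnitBall Ω s p (v m))
    (hC : ∀ m, ∫⁻ x, ‖v m x‖ₑ ≤ C) :
    ∃ (w : Euc N → ℝ) (φ : ℕ → ℕ), StrictMono φ ∧ Measurable w ∧
      ∀ᵐ x ∂volume.restrict Ω, Tendsto (fun k => v (φ k) x) atTop (𝓝 (w x)) := by
  obtain ⟨B, hB⟩ := exists_lintegral_enorm_sub_le hΩo hΩb hp
  have hint (m : ℕ) : Integrable (v m) :=
    ⟨(hv m).measurable.aestronglyMeasurable, (hC m).trans_lt ENNReal.coe_lt_top⟩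
  set e : ℕ → Euc N := TopologicalSpace.denseSeq (Euc N)
  set d : ℕ → ℝ := fun k => 1 / ((k : ℝ) + 1)
  have hd (k : ℕ) : 0 < d k := by positivity
  set a : ℕ → ℕ × ℕ → ℝ := fun m ki => ∫ y in Metric.ball (e ki.2) (d ki.1), v m y
  have ha (m : ℕ) : a m ∈ univ.pi fun _ : ℕ × ℕ => Icc (-(C : ℝ)) C := by
    intro ki _
    change a m ki ∈ Icc (-(C : ℝ)) C
    rw [mem_Icc, ← abs_le, ← Real.norm_eq_abs, ← coe_nnnorm, NNReal.coe_le_coe, ← ENNReal.coe_le_coe]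
    exact (enorm_integral_le_lintegral_enorm _).trans
      ((setLIntegral_le_lintegral _ _).trans (hC m))
  obtain ⟨α, -, φ, hφ, hlim⟩ := (isCompact_univ_pi fun _ => isCompact_Icc).tendsto_subseq ha
  have hmem (m : ℕ) : MemLp (v m) 1 (volume.restrict Ω) :=
    (memLp_one_iff_integrable.2 (hint m)).restrict Ω
  set f : ℕ → Lp ℝ 1 (volume.restrict Ω) := fun k => (hmem (φ k)).toLp (v (φ k))
  have hcauchy : CauchySeq f := by
    rw [EMetric.cauchySeq_iff]
    intro ε hε
    have hε2 : ε / 2 ≠ 0 := (ENNReal.half_pos hε.ne').ne'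
    obtain ⟨k, hk⟩ : ∃ k, B * ENNReal.ofReal (d k ^ s) < ε / 2 := by
      have h0 : Tendsto (fun k => (B : ENNReal) * ENNReal.ofReal (d k ^ s)) atTop (𝓝 0) := by
        have h1 : Tendsto (fun k => d k ^ s) atTop (𝓝 0) := by
          have := (tendsto_one_div_add_atTop_nhds_zero_nat (𝕜 := ℝ)).rpow_const
            (p := s) (.inr hp.pos.le)
          rwa [Real.zero_rpow hp.pos.ne'] at this
        have h2 := ENNReal.Tendsto.const_mul (a := (B : ENNReal)) (ENNReal.tendsto_ofReal h1)
          (.inr ENNReal.coe_ne_top)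
        simpa using h2
      exact (h0.eventually (gt_mem_nhds (pos_iff_ne_zero.2 hε2))).exists
    obtain ⟨D, hD⟩ := hB (d k) (hd k)
    obtain ⟨I, hI⟩ : ∃ I : Finset ℕ, closure Ω ⊆ ⋃ i ∈ I, Metric.ball (e i) (d k) := by
      refine hΩb.isCompact_closure.elim_finite_subcover _ (fun _ => Metric.isOpen_ball) ?_
      intro x _
      obtain ⟨i, hi⟩ := (TopologicalSpace.denseRange_denseSeq (Euc N)).exists_dist_lt x (hd k)
      exact mem_iUnion.2 ⟨i, hi⟩
    have hS : Tendsto (fun mn : ℕ × ℕ => (D : ENNReal) *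
        ∑ i ∈ I, ‖a (φ mn.1) (k, i) - a (φ mn.2) (k, i)‖ₑ) atTop (𝓝 0) := by
      have h1 : Tendsto (fun mn : ℕ × ℕ => ∑ i ∈ I, ‖a (φ mn.1) (k, i) - a (φ mn.2) (k, i)‖ₑ)
          atTop (𝓝 (∑ i ∈ I, 0)) := by
        refine tendsto_finsetSum _ fun i _ => ?_
        have h2 : Tendsto (fun m => a (φ m) (k, i)) atTop (𝓝 (α (k, i))) :=
          tendsto_pi_nhds.1 hlim (k, i)
        rw [← prod_atTop_atTop_eq]
        have h3 := ((h2.comp tendsto_fst).sub (h2.comp tendsto_snd)).enorm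
        simpa using h3
      have h2 := ENNReal.Tendsto.const_mul (a := (D : ENNReal)) h1 (.inr ENNReal.coe_ne_top)
      simpa using h2
    obtain ⟨⟨m₁, m₂⟩, hM⟩ := eventually_atTop.1
      (hS.eventually (gt_mem_nhds (pos_iff_ne_zero.2 hε2)))
    refine ⟨max m₁ m₂, fun m hm n hn => ?_⟩
    rw [Lp.edist_toLp_toLp, eLpNorm_one_eq_lintegral_enorm, ← ENNReal.add_halves ε]
    refine (hD I e (subset_closure.trans hI) _ _ (hv _) (hv _) (hint _) (hint _)).trans_lt
      (ENNReal.add_lt_add hk (hM (m, n) ⟨?_, ?_⟩))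
    · exact (le_max_left _ _).trans hm
    · exact (le_max_right _ _).trans hn
  obtain ⟨g, hg⟩ := cauchySeq_tendsto_of_complete hcauchy
  obtain ⟨ψ, hψ, hae⟩ := (tendstoInMeasure_of_tendsto_Lp hg).exists_seq_tendsto_ae
  refine ⟨g, φ ∘ ψ, hφ.comp hψ, (Lp.stronglyMeasurable g).measurable, ?_⟩
  have hall : ∀ᵐ x ∂volume.restrict Ω, ∀ k, f k x = v (φ k) x :=
    ae_all_iff.2 fun k => (hmem (φ k)).coeFn_toLp
  filter_upwards [hae, hall] with x hx hfx
  simpa only [hfx, Function.comp_apply] using hx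

/-- Vitali-type convergence of modulars: a.e. convergence together with a bound on a modular
with larger exponent. -/
lemma tendsto_lintegral_rpow_sub {Ω : Set (Euc N)} (hΩo : IsOpen Ω)
    (hΩb : Bornology.IsBounded Ω) {r : Euc N → ℝ} {ε M : ℝ} (hε : 0 < ε)
    (hrm : AEMeasurable r (volume.restrict Ω)) (hr0 : ∀ x ∈ Ω, 0 < r x)
    (hrM : ∀ x ∈ Ω, r x + ε ≤ M) {C : NNReal}
    {v : ℕ → Euc N → ℝ} {w : Euc N → ℝ} (hvm : ∀ k, Measurable (v k)) (hwm : Measurable w)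
    (hC : ∀ k, ∫⁻ x in Ω, ENNReal.ofReal (|v k x| ^ (r x + ε)) ≤ C)
    (hlim : ∀ᵐ x ∂volume.restrict Ω, Tendsto (fun k => v k x) atTop (𝓝 (w x))) :
    ∫⁻ x in Ω, ENNReal.ofReal (|w x| ^ (r x + ε)) ≤ C ∧
    Tendsto (fun k => ∫⁻ x in Ω, ENNReal.ofReal (|v k x - w x| ^ r x)) atTop (𝓝 0) := by
  have hΩt : volume Ω ≠ ⊤ := hΩb.measure_lt_top.ne
  have hmemΩ : ∀ᵐ x ∂volume.restrict Ω, x ∈ Ω := ae_restrict_mem hΩo.measurableSet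
  have hw : ∫⁻ x in Ω, ENNReal.ofReal (|w x| ^ (r x + ε)) ≤ C := by
    calc ∫⁻ x in Ω, ENNReal.ofReal (|w x| ^ (r x + ε))
        = ∫⁻ x in Ω, liminf (fun k => ENNReal.ofReal (|v k x| ^ (r x + ε))) atTop := by
          refine lintegral_congr_ae ?_
          filter_upwards [hlim, hmemΩ] with x hx hxΩ
          refine (Tendsto.liminf_eq (ENNReal.tendsto_ofReal ?_)).symm
          exact hx.abs.rpow_const (.inr (by linarith [hr0 x hxΩ]))
      _ ≤ liminf (fun k => ∫⁻ x in Ω, ENNReal.ofReal (|v k x| ^ (r x + ε))) atTop := by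
          refine lintegral_liminf_le' fun k => ?_
          have := hvm k
          fun_prop
      _ ≤ C := by
          refine (liminf_le_liminf (Eventually.of_forall hC)).trans ?_
          simp
  refine ⟨hw, ?_⟩
  set D : ENNReal := ENNReal.ofReal (2 ^ M) * (C + C)
  have hDt : D ≠ ⊤ := by finiteness
  have hdiff (k : ℕ) : ∫⁻ x in Ω, ENNReal.ofReal (|v k x - w x| ^ (r x + ε)) ≤ D := by
    calc ∫⁻ x in Ω, ENNReal.ofReal (|v k x - w x| ^ (r x + ε))
        ≤ ∫⁻ x in Ω, ENNReal.ofReal (2 ^ M) * (ENNReal.ofReal (|v k x| ^ (r x + ε)) +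
            ENNReal.ofReal (|w x| ^ (r x + ε))) := by
          refine setLIntegral_mono' hΩo.measurableSet fun x hx => ?_
          rw [← ENNReal.ofReal_add (by positivity) (by positivity),
            ← ENNReal.ofReal_mul (by positivity)]
          refine ENNReal.ofReal_le_ofReal ?_
          have hρ : 0 < r x + ε := by linarith [hr0 x hx]
          set a := |v k x|
          set b := |w x|
          have ha : 0 ≤ a := abs_nonneg _
          have hb : 0 ≤ b := abs_nonneg _
          have h1 : |v k x - w x| ≤ 2 * max a b := by
            have := abs_sub (v k x) (w x)
            linarith [le_max_left a b, le_max_right a b]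
          have h2 : max a b ^ (r x + ε) ≤ a ^ (r x + ε) + b ^ (r x + ε) := by
            have := Real.rpow_nonneg ha (r x + ε)
            have := Real.rpow_nonneg hb (r x + ε)
            rcases max_cases a b with h | h <;> rw [h.1] <;> linarith
          calc |v k x - w x| ^ (r x + ε) ≤ (2 * max a b) ^ (r x + ε) := by gcongr
            _ = 2 ^ (r x + ε) * max a b ^ (r x + ε) :=
              Real.mul_rpow (by norm_num) (le_max_of_le_left ha)
            _ ≤ 2 ^ M * (a ^ (r x + ε) + b ^ (r x + ε)) := by
              gcongr
              · norm_num
              · exact hrM x hx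
      _ ≤ D := by
          have := hvm k
          rw [lintegral_const_mul' _ _ ENNReal.ofReal_ne_top, lintegral_add_left' (by fun_prop)]
          exact mul_le_mul' le_rfl (add_le_add (hC k) hw)
  -- for every level `K ≥ 1`, split at `|v k - w| = K`
  have hsplit (K : ℝ) (hK : 1 ≤ K) (k : ℕ) :
      ∫⁻ x in Ω, ENNReal.ofReal (|v k x - w x| ^ r x) ≤
        (∫⁻ x in Ω, ENNReal.ofReal (min |v k x - w x| K ^ r x)) +
          ENNReal.ofReal (K ^ (-ε)) * D := by
    calc ∫⁻ x in Ω, ENNReal.ofReal (|v k x - w x| ^ r x)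
        ≤ ∫⁻ x in Ω, (ENNReal.ofReal (min |v k x - w x| K ^ r x) +
            ENNReal.ofReal (K ^ (-ε)) * ENNReal.ofReal (|v k x - w x| ^ (r x + ε))) := by
          refine lintegral_mono fun x => ?_
          rcases le_total (|v k x - w x|) K with h | h
          · rw [min_eq_left h]
            exact le_self_add
          · refine le_add_left ?_
            rw [← ENNReal.ofReal_mul (by positivity)]
            refine ENNReal.ofReal_le_ofReal ?_
            have hpos : 0 < |v k x - w x| := by linarith
            have hKpos : 0 < K := by linarith
            rw [Real.rpow_add hpos, Real.rpow_neg hKpos.le, inv_mul_eq_div,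
              le_div_iff₀ (by positivity)]
            gcongr
      _ ≤ _ := by
          have := hvm k
          rw [lintegral_add_left' (by fun_prop), lintegral_const_mul' _ _ ENNReal.ofReal_ne_top]
          exact add_le_add le_rfl (mul_le_mul' le_rfl (hdiff k))
  have htrunc (K : ℝ) (hK : 1 ≤ K) : Tendsto
      (fun k => ∫⁻ x in Ω, ENNReal.ofReal (min |v k x - w x| K ^ r x)) atTop (𝓝 0) := by
    have h0 : Tendsto (fun k => ∫⁻ x in Ω, ENNReal.ofReal (min |v k x - w x| K ^ r x)) atTop
        (𝓝 (∫⁻ x in Ω, 0)) := by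
      refine tendsto_lintegral_of_dominated_convergence' (fun _ => ENNReal.ofReal (K ^ M))
        (fun k => ?_) (fun k => ?_) ?_ ?_
      · have := hvm k
        fun_prop
      · filter_upwards [hmemΩ] with x hx
        refine ENNReal.ofReal_le_ofReal ?_
        have h1 : 0 ≤ min |v k x - w x| K := le_min (abs_nonneg _) (by linarith)
        calc min |v k x - w x| K ^ r x ≤ K ^ r x :=
              Real.rpow_le_rpow h1 (min_le_right _ _) (hr0 x hx).le
          _ ≤ K ^ M := Real.rpow_le_rpow_of_exponent_le hK (by linarith [hrM x hx])
      · simp only [lintegral_const, Measure.restrict_apply_univ]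
        finiteness
      · filter_upwards [hlim, hmemΩ] with x hx hxΩ
        have h1 : Tendsto (fun k => min |v k x - w x| K) atTop (𝓝 0) := by
          have := ((hx.sub_const (w x)).abs).min (tendsto_const_nhds (x := K))
          simpa [min_eq_left (by linarith : (0 : ℝ) ≤ K)] using this
        have h2 := h1.rpow_const (p := r x) (.inr (hr0 x hxΩ).le)
        rw [Real.zero_rpow (hr0 x hxΩ).ne'] at h2
        simpa using ENNReal.tendsto_ofReal h2
    simpa using h0
  rw [ENNReal.tendsto_nhds_zero]
  intro η hη
  have hη2 : 0 < η / 2 := ENNReal.half_pos hη.ne'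
  obtain ⟨K, hK1, hK⟩ : ∃ K : ℝ, 1 ≤ K ∧ ENNReal.ofReal (K ^ (-ε)) * D ≤ η / 2 := by
    have h1 := ENNReal.Tendsto.mul_const (b := D)
      (ENNReal.tendsto_ofReal (tendsto_rpow_neg_atTop hε)) (.inr hDt)
    rw [ENNReal.ofReal_zero, zero_mul] at h1
    exact ((eventually_ge_atTop 1).and (h1.eventually (ge_mem_nhds hη2))).exists
  filter_upwards [(htrunc K hK1).eventually (ge_mem_nhds hη2)] with k hk
  rw [← ENNReal.add_halves η]
  exact (hsplit K hK1 k).trans (add_le_add hk hK)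

lemma CPlus.one_lt {X : Type*} [TopologicalSpace X] {D : Set X} {g : X → ℝ} (h : CPlus D g)
    {x : X} (hx : x ∈ D) : 1 < g x := by
  have hb : BddBelow (g '' D) := by
    by_contra hb
    have := h.2.1
    rw [infOn, Real.sInf_of_not_bddBelow hb] at this
    linarith
  exact h.2.1.trans_le (csInf_le hb (mem_image_of_mem g hx))

lemma CPlus.le_supOn {X : Type*} [TopologicalSpace X] {D : Set X} {g : X → ℝ} (h : CPlus D g)
    {x : X} (hx : x ∈ D) : g x ≤ supOn g D :=
  le_csSup h.2.2 (mem_image_of_mem g hx)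

lemma CPlus.exponentBounds {s : ℝ} {p : Euc N × Euc N → ℝ} (hp : CPlus univ p) (hs : 0 < s)
    (hsp : s * supOn p univ < N) : ExponentBounds s p where
  pos := hs
  continuous := continuousOn_univ.1 hp.1
  one_lt z := hp.one_lt (mem_univ z)
  mul_lt z := (mul_le_mul_of_nonneg_left (hp.le_supOn (mem_univ z)) hs.le).trans_lt hsp

section Modular

variable {α : Type*} [MeasurableSpace α] {μ : Measure α} {q k f : α → ℝ}

lemma lintegral_rpow_const_mul_le {M : ℝ} (hk : ∀ z, 0 ≤ k z) (hq : ∀ᵐ z ∂μ, 0 ≤ q z)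
    (hM : ∀ᵐ z ∂μ, q z ≤ M) (c : ℝ) :
    ∫⁻ z, ENNReal.ofReal (|c * f z| ^ q z / k z) ∂μ ≤
      ENNReal.ofReal ((1 + |c|) ^ M) * ∫⁻ z, ENNReal.ofReal (|f z| ^ q z / k z) ∂μ := by
  rw [← lintegral_const_mul' _ _ ENNReal.ofReal_ne_top]
  refine lintegral_mono_ae ?_
  filter_upwards [hq, hM] with z h0 h1
  rw [← ENNReal.ofReal_mul (by positivity), ← mul_div_assoc, abs_mul,
    Real.mul_rpow (abs_nonneg _) (abs_nonneg _)]
  have h2 : |c| ^ q z ≤ (1 + |c|) ^ M :=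
    (Real.rpow_le_rpow (abs_nonneg c) (by linarith) h0).trans
      (Real.rpow_le_rpow_of_exponent_le (by linarith [abs_nonneg c]) h1)
  have := hk z
  gcongr

lemma lintegral_rpow_const_mul_le_of_le_one (hk : ∀ z, 0 ≤ k z) (hq : ∀ᵐ z ∂μ, 1 ≤ q z)
    {c : ℝ} (hc0 : 0 ≤ c) (hc1 : c ≤ 1) :
    ∫⁻ z, ENNReal.ofReal (|c * f z| ^ q z / k z) ∂μ ≤
      ENNReal.ofReal c * ∫⁻ z, ENNReal.ofReal (|f z| ^ q z / k z) ∂μ := by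
  rw [← lintegral_const_mul' _ _ ENNReal.ofReal_ne_top]
  refine lintegral_mono_ae ?_
  filter_upwards [hq] with z h0
  rw [← ENNReal.ofReal_mul hc0, ← mul_div_assoc, abs_mul,
    Real.mul_rpow (abs_nonneg _) (abs_nonneg _), abs_of_nonneg hc0]
  have h2 : c ^ q z ≤ c := by
    simpa using Real.rpow_le_rpow_of_exponent_ge' hc0 hc1 zero_le_one h0
  have := hk z
  gcongr

end Modular

section GagliardoScaling

variable {Ω : Set (Euc N)} {s : ℝ} {p : Euc N × Euc N → ℝ} {u : Euc N → ℝ}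

lemma lintegral_gagliardoDensity_const_mul_le {M : ℝ} (hp0 : ∀ z, 0 ≤ p z)
    (hpM : ∀ z, p z ≤ M) (c : ℝ) :
    ∫⁻ z, gagliardoDensity s p (fun x => c * u x) z ≤
      ENNReal.ofReal ((1 + |c|) ^ M) * ∫⁻ z, gagliardoDensity s p u z := by
  have := lintegral_rpow_const_mul_le (μ := (volume : Measure (Euc N × Euc N)))
    (k := fun z => ‖z.1 - z.2‖ ^ ((N : ℝ) + s * p z)) (f := fun z => u z.1 - u z.2)
    (fun z => by positivity) (.of_forall hp0) (.of_forall hpM) c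
  simpa only [gagliardoDensity, mul_sub] using this

lemma lintegral_gagliardoDensity_const_mul_le_of_le_one (hp1 : ∀ z, 1 ≤ p z) {c : ℝ}
    (hc0 : 0 ≤ c) (hc1 : c ≤ 1) :
    ∫⁻ z, gagliardoDensity s p (fun x => c * u x) z ≤
      ENNReal.ofReal c * ∫⁻ z, gagliardoDensity s p u z := by
  have := lintegral_rpow_const_mul_le_of_le_one (μ := (volume : Measure (Euc N × Euc N)))
    (k := fun z => ‖z.1 - z.2‖ ^ ((N : ℝ) + s * p z)) (f := fun z => u z.1 - u z.2)
    (fun z => by positivity) (.of_forall hp1) hc0 hc1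
  simpa only [gagliardoDensity, mul_sub] using this

lemma ofReal_gagliardo_integrand {η : ℝ} (hη : 0 < η) (z : Euc N × Euc N) :
    ENNReal.ofReal (|u z.1 - u z.2| ^ p z / (η ^ p z * ‖z.1 - z.2‖ ^ ((N : ℝ) + s * p z))) =
      gagliardoDensity s p (fun x => η⁻¹ * u x) z := by
  rw [gagliardoDensity, ← mul_sub, abs_mul, abs_of_pos (inv_pos.2 hη),
    Real.mul_rpow (inv_pos.2 hη).le (abs_nonneg _), Real.inv_rpow hη.le, ← div_div]
  congr 2
  rw [div_eq_inv_mul]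

lemma MemX0.lintegral_gagliardoDensity_ne_top (hp : CPlus univ p) (hu : MemX0 Ω s p u) (c : ℝ) :
    ∫⁻ z, gagliardoDensity s p (fun x => c * u x) z ≠ ⊤ := by
  obtain ⟨-, -, η, hη, hint⟩ := hu
  have h1 := hint.lintegral_lt_top
  simp only [ofReal_gagliardo_integrand hη] at h1
  have h2 := lintegral_gagliardoDensity_const_mul_le (s := s) (p := p)
    (u := fun x => η⁻¹ * u x) (fun z => (zero_le_one.trans (hp.one_lt (mem_univ z)).le))
    (fun z => hp.le_supOn (mem_univ z)) (c * η)
  have h3 : (fun x => c * η * (η⁻¹ * u x)) = fun x => c * u x := by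
    ext x
    field_simp
  rw [h3] at h2
  exact (h2.trans_lt (ENNReal.mul_lt_top ENNReal.ofReal_lt_top h1)).ne

lemma MemX0.gagliardoOn_le_one_iff (hp : CPlus univ p) (hu : MemX0 Ω s p u) {η : ℝ}
    (hη : 0 < η) :
    gagliardoOn univ s p u η ≤ 1 ↔
      ∫⁻ z, gagliardoDensity s p (fun x => η⁻¹ * u x) z ≤ 1 := by
  have hne := hu.lintegral_gagliardoDensity_ne_top hp η⁻¹
  have hm : Measurable (gagliardoDensity s p (fun x => η⁻¹ * u x)) :=
    measurable_gagliardoDensity (continuousOn_univ.1 hp.1) (hu.1.const_mul _)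
  have h1 : gagliardoOn univ s p u η =
      (∫⁻ z, gagliardoDensity s p (fun x => η⁻¹ * u x) z).toReal := by
    rw [← integral_toReal hm.aemeasurable (ae_lt_top hm hne), gagliardoOn, setIntegral_univ]
    refine integral_congr_ae (.of_forall fun z => ?_)
    simp only [← ofReal_gagliardo_integrand hη]
    rw [ENNReal.toReal_ofReal (by positivity)]
  rw [h1, ← ENNReal.toReal_one, ENNReal.toReal_le_toReal hne ENNReal.one_ne_top]

lemma X0Norm_nonneg : 0 ≤ X0Norm s p u :=
  Real.sInf_nonneg fun _ h => h.1.le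

lemma MemX0.inUnitBall_of_X0Norm_lt (hp : CPlus univ p) (hu : MemX0 Ω s p u) {η : ℝ}
    (hη : X0Norm s p u < η) : InUnitBall Ω s p fun x => η⁻¹ * u x := by
  have hp1 (z) : 1 ≤ p z := (hp.one_lt (mem_univ z)).le
  have hη0 : 0 < η := X0Norm_nonneg.trans_lt hη
  have hne : {η : ℝ | 0 < η ∧ gagliardoOn univ s p u η ≤ 1}.Nonempty := by
    set G := ∫⁻ z, gagliardoDensity s p u z
    have hG : G ≠ ⊤ := by simpa using hu.lintegral_gagliardoDensity_ne_top hp 1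
    set K : ℝ := max 1 G.toReal
    have hK : 0 < K := zero_lt_one.trans_le (le_max_left _ _)
    refine ⟨K, hK, (hu.gagliardoOn_le_one_iff hp hK).2 ?_⟩
    refine (lintegral_gagliardoDensity_const_mul_le_of_le_one hp1 (inv_pos.2 hK).le
      (inv_le_one_of_one_le₀ (le_max_left _ _))).trans ?_
    change _ * G ≤ 1
    rw [← ENNReal.ofReal_toReal hG, ← ENNReal.ofReal_mul (inv_pos.2 hK).le,
      ENNReal.ofReal_le_one, ← div_eq_inv_mul]
    exact div_le_one_of_le₀ (le_max_right _ _) hK.le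
  obtain ⟨η', ⟨hη'0, hη'⟩, hlt⟩ := exists_lt_of_csInf_lt hne hη
  rw [hu.gagliardoOn_le_one_iff hp hη'0] at hη'
  refine ⟨hu.1.const_mul _, hu.2.1.mono fun x hx h => by simp [hx h], ?_⟩
  have h3 : (fun x => η⁻¹ * u x) = fun x => η⁻¹ * η' * (η'⁻¹ * u x) := by
    ext x
    field_simp
  rw [h3]
  have hle : η⁻¹ * η' ≤ 1 := by
    rw [← div_eq_inv_mul]
    exact div_le_one_of_le₀ hlt.le hη0.le
  refine (lintegral_gagliardoDensity_const_mul_le_of_le_one hp1 (by positivity) hle).trans ?_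
  exact mul_le_one' (ENNReal.ofReal_le_one.2 hle) hη'

end GagliardoScaling

section Lebesgue

variable {Ω : Set (Euc N)} {r : Euc N → ℝ} {u : Euc N → ℝ}

lemma luxNorm_nonneg : 0 ≤ luxNorm Ω r u :=
  Real.sInf_nonneg fun _ h => h.1.le

lemma luxNorm_le {η : ℝ} (hη : 0 < η)
    (h : ∫⁻ x in Ω, ENNReal.ofReal (|η⁻¹ * u x| ^ r x) ≤ 1) : luxNorm Ω r u ≤ η := by
  refine csInf_le ⟨0, fun _ h => h.1.le⟩ ⟨hη, ?_⟩
  have h1 : (fun x => (|u x| / η) ^ r x) = fun x => |η⁻¹ * u x| ^ r x := by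
    ext x
    rw [abs_mul, abs_of_pos (inv_pos.2 hη), div_eq_inv_mul]
  rw [h1]
  by_cases hm : AEStronglyMeasurable (fun x => |η⁻¹ * u x| ^ r x) (volume.restrict Ω)
  · rw [integral_eq_lintegral_of_nonneg_ae (.of_forall fun x => by positivity) hm]
    exact ENNReal.toReal_le_of_le_ofReal zero_le_one (by simpa using h)
  · rw [integral_non_aestronglyMeasurable hm]
    exact zero_le_one

lemma memVarLp_of_lintegral_ne_top (hr : AEMeasurable r (volume.restrict Ω)) (hu : Measurable u)
    (h : ∫⁻ x in Ω, ENNReal.ofReal (|u x| ^ r x) ≠ ⊤) : MemVarLp Ω r u := by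
  refine ⟨hu.aemeasurable, ?_, ?_⟩
  · exact ((measurable_norm.comp hu).aemeasurable.pow hr).aestronglyMeasurable
  · rw [hasFiniteIntegral_iff_ofReal (.of_forall fun x => by positivity)]
    exact h.lt_top

end Lebesgue

lemma exists_add_lt_pstar {Ω : Set (Euc N)} (hΩb : Bornology.IsBounded Ω) (hΩne : Ω.Nonempty)
    {s : ℝ} {p : Euc N × Euc N → ℝ} (hp : ExponentBounds s p) {r : Euc N → ℝ}
    (hr : ContinuousOn r (closure Ω)) (hrsub : ∀ x ∈ closure Ω, r x < pstar N s p x) :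
    ∃ ε > 0, ∀ x ∈ closure Ω, r x + ε < pstar N s p x := by
  have hc : Continuous fun x : Euc N => p (x, x) :=
    hp.continuous.comp (continuous_id.prodMk continuous_id)
  have hs : Continuous (pstar N s p) :=
    (continuous_const.mul hc).div (continuous_const.sub (continuous_const.mul hc))
      fun x => (sub_pos.2 (hp.mul_lt (x, x))).ne'
  obtain ⟨x₀, hx₀, hmin⟩ := hΩb.isCompact_closure.exists_isMinOn hΩne.closure
    (hs.continuousOn.sub hr)
  have h0 := hrsub x₀ hx₀
  refine ⟨(pstar N s p x₀ - r x₀) / 2, by linarith, fun x hx => ?_⟩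
  have : pstar N s p x₀ - r x₀ ≤ pstar N s p x - r x := hmin hx
  linarith

/-- `|a|^t ≤ 1 + |a|^q` for `0 ≤ t ≤ q`. -/
lemma abs_rpow_le_one_add_rpow (a : ℝ) {t q : ℝ} (ht : 0 ≤ t) (hq : t ≤ q) :
    |a| ^ t ≤ 1 + |a| ^ q := by
  rcases le_total |a| 1 with h | h
  · linarith [Real.rpow_le_one (abs_nonneg a) h ht, Real.rpow_nonneg (abs_nonneg a) q]
  · linarith [Real.rpow_le_rpow_of_exponent_le h hq]

lemma setLIntegral_rpow_le {Ω : Set (Euc N)} (hΩ : MeasurableSet Ω) {t q u : Euc N → ℝ}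
    (ht : ∀ x ∈ Ω, 0 ≤ t x) (hq : ∀ x ∈ Ω, t x ≤ q x) :
    ∫⁻ x in Ω, ENNReal.ofReal (|u x| ^ t x) ≤
      volume Ω + ∫⁻ x in Ω, ENNReal.ofReal (|u x| ^ q x) := by
  calc _ ≤ ∫⁻ x in Ω, (1 + ENNReal.ofReal (|u x| ^ q x)) := by
        refine setLIntegral_mono_ae' hΩ (.of_forall fun x hx => ?_)
        rw [← ENNReal.ofReal_one, ← ENNReal.ofReal_add zero_le_one (by positivity)]
        exact ENNReal.ofReal_le_ofReal (abs_rpow_le_one_add_rpow _ (ht x hx) (hq x hx))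
    _ = _ := by rw [lintegral_add_left measurable_const, setLIntegral_one]

/-- continuous and compact embedding `X₀ ↪ L^{r(x)}(Ω)`. -/
theorem X0_compact_embedding
    (N : ℕ) (hN : 2 ≤ N) (Ω : Set (Euc N))
    (hΩo : IsOpen Ω) (hΩb : Bornology.IsBounded Ω) (hΩne : Ω.Nonempty)
    (s : ℝ) (hs0 : 0 < s) (hs1 : s < 1)
    (p : Euc N × Euc N → ℝ) (hp : CPlus univ p)
    (hpsym : ∀ x y : Euc N, p (x, y) = p (y, x))
    (hspN : s * supOn p univ < (N : ℝ))
    (r : Euc N → ℝ) (hr : CPlus (closure Ω) r)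
    (hrsub : ∀ x ∈ closure Ω, r x < pstar N s p x) :
    ∃ C > (0 : ℝ),
      (∀ u : Euc N → ℝ, MemX0 Ω s p u →
        MemVarLp Ω r u ∧ luxNorm Ω r u ≤ C * X0Norm s p u) ∧
      (∀ um : ℕ → Euc N → ℝ, (∀ m, MemX0 Ω s p (um m)) →
        (∃ B : ℝ, ∀ m, X0Norm s p (um m) ≤ B) →
        ∃ (u : Euc N → ℝ) (φ : ℕ → ℕ), StrictMono φ ∧ MemVarLp Ω r u ∧
          Tendsto (fun k => luxNorm Ω r (fun x => um (φ k) x - u x)) atTop (𝓝 0)) := by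
  have hpe := hp.exponentBounds hs0 hspN
  obtain ⟨ε, hε, hεr⟩ := exists_add_lt_pstar hΩb hΩne hpe hr.1 hrsub
  have hr1 (x) (hx : x ∈ Ω) : 1 ≤ r x := (hr.one_lt (subset_closure hx)).le
  have hr0 (x) (hx : x ∈ Ω) : 0 ≤ r x := zero_le_one.trans (hr1 x hx)
  set M := supOn r (closure Ω)
  have hrM (x) (hx : x ∈ Ω) : r x ≤ M := hr.le_supOn (subset_closure hx)
  have hΩm := hΩo.measurableSet
  have hr1ae := ae_restrict_of_forall_mem (μ := volume) hΩm hr1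
  have hr0ae := ae_restrict_of_forall_mem (μ := volume) hΩm hr0
  have hrMae := ae_restrict_of_forall_mem (μ := volume) hΩm hrM
  have hrm : AEMeasurable r (volume.restrict Ω) := (hr.1.mono subset_closure).aemeasurable hΩm
  obtain ⟨C₁, hC₁⟩ := exists_lintegral_rpow_le hN hΩo hΩb hpe (r := fun x => r x + ε)
    (hr.1.add continuousOn_const) (fun x hx => by linarith [hr.one_lt hx]) hεr
  have hvol : volume Ω ≠ ⊤ := hΩb.measure_lt_top.ne
  set C₂ : NNReal := max 1 ((volume Ω).toNNReal + C₁)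
  have hC₂ : volume Ω + C₁ ≤ C₂ := by
    rw [← ENNReal.coe_toNNReal hvol, ← ENNReal.coe_add, ENNReal.coe_le_coe]
    exact le_max_right _ _
  have hC₂1 : (1 : ℝ) ≤ C₂ := by exact_mod_cast le_max_left _ _
  have hC₂0 : (0 : ℝ) < C₂ := zero_lt_one.trans_le hC₂1
  have hmod {v : Euc N → ℝ} (hv : InUnitBall Ω s p v) :
      ∫⁻ x in Ω, ENNReal.ofReal (|v x| ^ r x) ≤ C₂ := by
    refine (setLIntegral_rpow_le (q := fun x => r x + ε) hΩm hr0 fun x _ => by linarith).trans ?_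
    exact (add_le_add_right (hC₁ v hv) _).trans hC₂
  have hL1 {v : Euc N → ℝ} (hv : InUnitBall Ω s p v) : ∫⁻ x, ‖v x‖ₑ ≤ C₂ := by
    have h1 : ∫⁻ x, ‖v x‖ₑ = ∫⁻ x in Ω, ENNReal.ofReal (|v x| ^ (1 : ℝ)) := by
      rw [← lintegral_indicator hΩm]
      refine lintegral_congr_ae ?_
      filter_upwards [hv.ae_zero] with x hx
      by_cases h : x ∈ Ω
      · simp [h, Real.enorm_eq_ofReal_abs]
      · simp [h, hx h]
    rw [h1]
    refine (setLIntegral_rpow_le (t := fun _ => 1) (q := fun x => r x + ε) hΩm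
      (fun _ _ => zero_le_one) fun x hx => by linarith [hr1 x hx]).trans ?_
    exact (add_le_add_right (hC₁ v hv) _).trans hC₂
  have hscale (c : ℝ) (v : Euc N → ℝ) : ∫⁻ x in Ω, ENNReal.ofReal (|c * v x| ^ r x) ≤
      ENNReal.ofReal ((1 + |c|) ^ M) * ∫⁻ x in Ω, ENNReal.ofReal (|v x| ^ r x) := by
    simpa using lintegral_rpow_const_mul_le (k := fun _ => 1) (f := v)
      (fun _ => zero_le_one) hr0ae hrMae c
  have hmem {c : ℝ} {v : Euc N → ℝ} (hv : Measurable v)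
      (h : ∫⁻ x in Ω, ENNReal.ofReal (|v x| ^ r x) ≠ ⊤) : MemVarLp Ω r fun x => c * v x :=
    memVarLp_of_lintegral_ne_top hrm (hv.const_mul c)
      ((hscale c v).trans_lt (ENNReal.mul_lt_top ENNReal.ofReal_lt_top h.lt_top)).ne
  refine ⟨C₂, hC₂0, fun u hu => ⟨?_, ?_⟩, ?_⟩
  · have hη : X0Norm s p u < X0Norm s p u + 1 := by linarith
    have hη0 : X0Norm s p u + 1 ≠ 0 := (X0Norm_nonneg.trans_lt hη).ne'
    have hv := hu.inUnitBall_of_X0Norm_lt hp hη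
    have := hmem (c := X0Norm s p u + 1) hv.measurable
      ((hmod hv).trans_lt ENNReal.coe_lt_top).ne
    simpa only [mul_inv_cancel_left₀ hη0] using this
  · rw [← div_le_iff₀' hC₂0]
    refine le_of_forall_gt_imp_ge_of_dense fun η hη => ?_
    have hη0 : 0 < η := X0Norm_nonneg.trans_lt hη
    rw [div_le_iff₀' hC₂0]
    have hv := hu.inUnitBall_of_X0Norm_lt hp hη
    refine luxNorm_le (by positivity) ?_
    have h1 := lintegral_rpow_const_mul_le_of_le_one (k := fun _ => 1)
      (f := fun x => η⁻¹ * u x) (fun _ => zero_le_one) hr1ae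
      (inv_pos.2 hC₂0).le (inv_le_one_of_one_le₀ hC₂1)
    simp only [div_one, ← mul_assoc, ← mul_inv] at h1
    refine h1.trans ((mul_le_mul_right (hmod hv) _).trans_eq ?_)
    rw [← ENNReal.ofReal_coe_nnreal, ← ENNReal.ofReal_mul (inv_pos.2 hC₂0).le,
      inv_mul_cancel₀ hC₂0.ne', ENNReal.ofReal_one]
  · rintro um hum ⟨B, hB⟩
    set η := max B 0 + 1
    have hη0 : 0 < η := by positivity
    have hv (m : ℕ) : InUnitBall Ω s p fun x => η⁻¹ * um m x :=
      (hum m).inUnitBall_of_X0Norm_lt hp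
        ((hB m).trans_lt ((le_max_left B 0).trans_lt (lt_add_one _)))
    obtain ⟨w, φ, hφ, hwm, hlim⟩ := exists_subseq_ae_tendsto hΩo hΩb hpe hv fun m => hL1 (hv m)
    obtain ⟨hw, hconv⟩ := tendsto_lintegral_rpow_sub hΩo hΩb hε hrm
      (fun x hx => zero_lt_one.trans_le (hr1 x hx)) (fun x hx => add_le_add_left (hrM x hx) ε)
      (fun k => (hv (φ k)).measurable) hwm (fun k => hC₁ _ (hv (φ k))) hlim
    refine ⟨fun x => η * w x, φ, hφ, hmem hwm ?_, ?_⟩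
    · refine ((setLIntegral_rpow_le (q := fun x => r x + ε) hΩm hr0
        fun x _ => by linarith).trans_lt (ENNReal.add_lt_top.2 ⟨hvol.lt_top, ?_⟩)).ne
      exact hw.trans_lt ENNReal.coe_lt_top
    · rw [Metric.tendsto_atTop']
      intro δ hδ
      have h1 := ENNReal.Tendsto.const_mul (a := ENNReal.ofReal ((1 + |(δ / 2)⁻¹ * η|) ^ M)) hconv
        (.inr ENNReal.ofReal_ne_top)
      rw [mul_zero] at h1
      obtain ⟨n, hn⟩ := eventually_atTop.1 (h1.eventually (gt_mem_nhds zero_lt_one))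
      refine ⟨n, fun k hk => ?_⟩
      rw [Real.dist_0_eq_abs, abs_of_nonneg luxNorm_nonneg]
      refine (luxNorm_le (half_pos hδ) (le_trans ?_ (hn k hk.le).le)).trans_lt (half_lt_self hδ)
      refine le_of_eq_of_le ?_ (hscale ((δ / 2)⁻¹ * η) _)
      congr! 5 with x
      field_simp
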